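/- Let Ω ⊂ ℝⁿ (n ≥ 2) be a bounded open set and let 1 < p < ∞. Let σ₁, σ₂ : closure(Ω) → ℝ be continuous with σⱼ ≥ c₀ > 0, let A : closure(Ω) → (n×n real matrices) be continuous with A(x) symmetric and A(x)ξ·ξ ≥ c₀|ξ|² for all x ∈ Ω, ξ ∈ ℝⁿ, and assume σ₁ ≥ σ₂ on Ω. Suppose there exist u₂ ∈ C¹(closure Ω) which is a weak solution of div(σ₂|A∇u₂·∇u₂|^{(p−2)/2}A∇u₂) = 0 in Ω with |∇u₂(x)| ≥ 1/2 for all x ∈ Ω, and u₁ ∈ C¹(closure Ω) which is a weak solution of div(σ₁|A∇u₁·∇u₁|^{(p−2)/2}A∇u₁) = 0 in Ω with u₁ = u₂ on ∂Ω and E_{σ₁,A}(u₁) = E_{σ₂,A}(u₂) (which holds when the nonlinear Dirichlet-to-Neumann maps of σ₁ and σ₂ coincide). Then σ₁ = σ₂ in Ω. -/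

import Mathlib

open MeasureTheory Real
open scoped RealInnerProductSpace

/-- The linear action of an `n × n` real matrix on Euclidean space, as a
continuous linear map. -/
noncomputable def matCLM {n : ℕ} (M : Matrix (Fin n) (Fin n) ℝ) :
    EuclideanSpace ℝ (Fin n) →L[ℝ] EuclideanSpace ℝ (Fin n) :=
  LinearMap.toContinuousLinearMap (Matrix.toEuclideanLin M)

/-- `u` is a weak solution of `div(σ |A∇u·∇u|^((p-2)/2) A∇u) = 0` in `Ω`,
tested against `C¹(closure Ω)` functions vanishing on `∂Ω`. -/
def IsWeakSolution {n : ℕ} (Ω : Set (EuclideanSpace ℝ (Fin n))) (p : ℝ)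
    (σ : EuclideanSpace ℝ (Fin n) → ℝ)
    (A : EuclideanSpace ℝ (Fin n) → Matrix (Fin n) (Fin n) ℝ)
    (u : EuclideanSpace ℝ (Fin n) → ℝ) : Prop :=
  ∀ φ : EuclideanSpace ℝ (Fin n) → ℝ, ContDiffOn ℝ 1 φ (closure Ω) →
    (∀ x ∈ frontier Ω, φ x = 0) →
    ∫ x in Ω, σ x * |⟪matCLM (A x) (gradient u x), gradient u x⟫| ^ ((p - 2) / 2)
      * ⟪matCLM (A x) (gradient u x), gradient φ x⟫ = 0

/-- The `p`-Dirichlet energy `E_{σ,A}(v) = ∫_Ω σ |A∇v·∇v|^(p/2) dx`. -/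
noncomputable def energy {n : ℕ} (Ω : Set (EuclideanSpace ℝ (Fin n))) (p : ℝ)
    (σ : EuclideanSpace ℝ (Fin n) → ℝ)
    (A : EuclideanSpace ℝ (Fin n) → Matrix (Fin n) (Fin n) ℝ)
    (v : EuclideanSpace ℝ (Fin n) → ℝ) : ℝ :=
  ∫ x in Ω, σ x * |⟪matCLM (A x) (gradient v x), gradient v x⟫| ^ (p / 2)

/-- A `C¹` function on the closure of a bounded open set has bounded gradient. -/
theorem ContDiffOn.exists_norm_gradient_le {E : Type*} [NormedAddCommGroup E]
    [InnerProductSpace ℝ E] [ProperSpace E] [CompleteSpace E] {Ω : Set E} (hΩ : IsOpen Ω)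
    (hb : Bornology.IsBounded Ω) {u : E → ℝ} (hu : ContDiffOn ℝ 1 u (closure Ω)) :
    ∃ C, ∀ x ∈ Ω, ‖gradient u x‖ ≤ C := by
  have key : ∃ C, ∀ x ∈ closure Ω, x ∈ Ω → ‖gradient u x‖ ≤ C := by
    refine hb.isCompact_closure.induction_on
      (p := fun s => ∃ C, ∀ x ∈ s, x ∈ Ω → ‖gradient u x‖ ≤ C) ⟨0, by simp⟩ ?_ ?_ ?_
    · rintro s t hst ⟨C, hC⟩
      exact ⟨C, fun x hx => hC x (hst hx)⟩
    · rintro s t ⟨C, hC⟩ ⟨D, hD⟩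
      refine ⟨max C D, fun x hx hxΩ => ?_⟩
      rcases hx with hx | hx
      · exact (hC x hx hxΩ).trans (le_max_left _ _)
      · exact (hD x hx hxΩ).trans (le_max_right _ _)
    · intro x hx
      obtain ⟨v, hv, -, -, f', hf', hcont⟩ :=
        (contDiffWithinAt_succ_iff_hasFDerivWithinAt' (n := 0) (by simp)).1
          (by simpa using hu x hx)
      rw [Set.insert_eq_of_mem hx] at hv
      have hb' : ∀ᶠ y in nhdsWithin x (closure Ω), ‖f' y‖ < ‖f' x‖ + 1 :=
        hcont.continuousWithinAt.norm.eventually (gt_mem_nhds (lt_add_one _))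
      refine ⟨_, Filter.inter_mem hv hb', ‖f' x‖ + 1, fun y hy hyΩ => ?_⟩
      have hd : HasFDerivAt u (f' y) y :=
        (hf' y hy.1).hasFDerivAt (Filter.mem_of_superset (hΩ.mem_nhds hyΩ) subset_closure)
      rw [gradient, hd.fderiv, LinearIsometryEquiv.norm_map]
      exact le_of_lt hy.2
  obtain ⟨C, hC⟩ := key
  exact ⟨C, fun x hx => hC x (subset_closure hx) hx⟩

/-- A `C¹` function on an open set has continuous gradient. -/
theorem ContDiffOn.continuousOn_gradient {E : Type*} [NormedAddCommGroup E]
    [InnerProductSpace ℝ E] [CompleteSpace E] {Ω : Set E} (hΩ : IsOpen Ω) {u : E → ℝ}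
    (hu : ContDiffOn ℝ 1 u Ω) : ContinuousOn (gradient u) Ω :=
  (InnerProductSpace.toDual ℝ E).symm.continuous.comp_continuousOn
    (hu.continuousOn_fderiv_of_isOpen hΩ le_rfl)

theorem continuous_matCLM {n : ℕ} :
    Continuous (matCLM : Matrix (Fin n) (Fin n) ℝ → _) :=
  LinearMap.continuous_of_finiteDimensional
    ((Matrix.toEuclideanLin (𝕜 := ℝ) (m := Fin n) (n := Fin n)).trans
      LinearMap.toContinuousLinearMap).toLinearMap

theorem inner_matCLM_comm {n : ℕ} {M : Matrix (Fin n) (Fin n) ℝ} (hM : M.IsSymm)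
    (v w : EuclideanSpace ℝ (Fin n)) : ⟪matCLM M v, w⟫ = ⟪matCLM M w, v⟫ := by
  have h : (Matrix.toEuclideanLin M).IsSymmetric :=
    Matrix.isSymmetric_toEuclideanLin_iff.2 (by simpa [Matrix.IsHermitian] using hM.eq)
  rw [real_inner_comm v]
  exact h v w

/-- Cauchy–Schwarz inequality for a positive symmetric matrix. -/
theorem inner_matCLM_sq_le {n : ℕ} {M : Matrix (Fin n) (Fin n) ℝ} (hM : M.IsSymm)
    (hpos : ∀ ξ, 0 ≤ ⟪matCLM M ξ, ξ⟫) {η : EuclideanSpace ℝ (Fin n)}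
    (hη : 0 < ⟪matCLM M η, η⟫) (ξ : EuclideanSpace ℝ (Fin n)) :
    ⟪matCLM M η, ξ⟫ ^ 2 ≤ ⟪matCLM M η, η⟫ * ⟪matCLM M ξ, ξ⟫ := by
  have h := hpos (⟪matCLM M η, η⟫ • ξ - ⟪matCLM M η, ξ⟫ • η)
  simp only [map_sub, map_smul, inner_sub_left, inner_sub_right, real_inner_smul_left,
    real_inner_smul_right, inner_matCLM_comm hM ξ η] at h
  refine le_of_mul_le_mul_left ?_ hη
  nlinarith

/-- The convexity inequality for `ξ ↦ |Aξ·ξ|^(p/2)`, in terms of `a = Aη·η`, `b = Aξ·ξ` and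
`c = Aη·ξ`. -/
theorem rpow_half_add_le {p a b c : ℝ} (hp : 1 ≤ p) (ha : 0 < a) (hb : 0 ≤ b)
    (hc : c ^ 2 ≤ a * b) :
    a ^ (p / 2) + p * (a ^ ((p - 2) / 2) * (c - a)) ≤ b ^ (p / 2) := by
  have hr : c / a ≤ √(b / a) := by
    apply Real.le_sqrt_of_sq_le
    rw [div_pow, div_le_div_iff₀ (by positivity) ha]
    nlinarith
  have hbern := one_add_mul_self_le_rpow_one_add
    (s := √(b / a) - 1) (by linarith [Real.sqrt_nonneg (b / a)]) hp
  rw [add_sub_cancel, Real.sqrt_eq_rpow, ← Real.rpow_mul (by positivity),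
    ← Real.sqrt_eq_rpow, one_div_mul_eq_div, Real.div_rpow hb ha.le,
    le_div_iff₀ (by positivity)] at hbern
  have hsplit : a ^ (p / 2) = a ^ ((p - 2) / 2) * a := by
    rw [← Real.rpow_add_one ha.ne']
    congr 1
    ring
  calc a ^ (p / 2) + p * (a ^ ((p - 2) / 2) * (c - a))
      = (1 + p * (c / a - 1)) * a ^ (p / 2) := by
        rw [hsplit]
        field_simp
    _ ≤ (1 + p * (√(b / a) - 1)) * a ^ (p / 2) := by gcongr
    _ ≤ b ^ (p / 2) := hbern

/-- A continuous bounded function on a bounded open set is integrable. -/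
theorem ContinuousOn.integrableOn_of_forall_abs_le {E : Type*} [NormedAddCommGroup E]
    [InnerProductSpace ℝ E] [FiniteDimensional ℝ E] [MeasurableSpace E] [BorelSpace E]
    {Ω : Set E} (hΩ : IsOpen Ω) (hb : Bornology.IsBounded Ω) {f : E → ℝ}
    (hf : ContinuousOn f Ω) {C : ℝ} (hC : ∀ x ∈ Ω, |f x| ≤ C) : IntegrableOn f Ω :=
  IntegrableOn.of_bound hb.measure_lt_top (hf.aestronglyMeasurable hΩ.measurableSet) C
    ((ae_restrict_iff' hΩ.measurableSet).2 (Filter.Eventually.of_forall hC))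

/-- **Core of the higher-dimensional uniqueness theorem** (Theorem 3.1): if
`σ₁ ≥ σ₂` are continuous conductivities, `u₂` is a weak solution for `σ₂`
whose gradient never vanishes (`|∇u₂| ≥ 1/2` in `Ω`), and `u₁` is a weak
solution for `σ₁` with the same boundary values and the same energy (as
happens when the nonlinear DN maps coincide), then `σ₁ = σ₂` in `Ω`. -/
theorem interior_uniqueness_higher_dim
    {n : ℕ} (hn : 2 ≤ n) (Ω : Set (EuclideanSpace ℝ (Fin n)))
    (hΩopen : IsOpen Ω) (hΩbdd : Bornology.IsBounded Ω)
    (p : ℝ) (hp1 : 1 < p) (c₀ : ℝ) (hc₀ : 0 < c₀)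
    (σ₁ σ₂ : EuclideanSpace ℝ (Fin n) → ℝ)
    (hσ₁cont : ContinuousOn σ₁ (closure Ω)) (hσ₂cont : ContinuousOn σ₂ (closure Ω))
    (hσ₁pos : ∀ x ∈ Ω, c₀ ≤ σ₁ x) (hσ₂pos : ∀ x ∈ Ω, c₀ ≤ σ₂ x)
    (A : EuclideanSpace ℝ (Fin n) → Matrix (Fin n) (Fin n) ℝ)
    (hAcont : ContinuousOn A (closure Ω))
    (hAsymm : ∀ x ∈ Ω, (A x).IsSymm)
    (hAell : ∀ x ∈ Ω, ∀ ξ : EuclideanSpace ℝ (Fin n),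
      c₀ * ‖ξ‖ ^ 2 ≤ ⟪matCLM (A x) ξ, ξ⟫)
    (hmono : ∀ x ∈ Ω, σ₂ x ≤ σ₁ x)
    (u₁ u₂ : EuclideanSpace ℝ (Fin n) → ℝ)
    (hu₁C1 : ContDiffOn ℝ 1 u₁ (closure Ω)) (hu₂C1 : ContDiffOn ℝ 1 u₂ (closure Ω))
    (hu₂sol : IsWeakSolution Ω p σ₂ A u₂)
    (hu₂grad : ∀ x ∈ Ω, (1 : ℝ) / 2 ≤ ‖gradient u₂ x‖)
    (hu₁sol : IsWeakSolution Ω p σ₁ A u₁)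
    (hbdry : ∀ x ∈ frontier Ω, u₁ x = u₂ x)
    (henergy : energy Ω p σ₁ A u₁ = energy Ω p σ₂ A u₂) :
    ∀ x ∈ Ω, σ₁ x = σ₂ x := by
  have hsub : Ω ⊆ closure Ω := subset_closure
  have hK := hΩbdd.isCompact_closure
  have hu₁ := hu₁C1.mono hsub
  have hu₂ := hu₂C1.mono hsub
  have hφC1 := hu₁C1.sub hu₂C1
  have hg₁ := hu₁.continuousOn_gradient hΩopen
  have hg₂ := hu₂.continuousOn_gradient hΩopen
  have hgφ := (hφC1.mono hsub).continuousOn_gradient hΩopen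
  have hM : ContinuousOn (fun x => matCLM (A x)) (closure Ω) :=
    continuous_matCLM.comp_continuousOn hAcont
  obtain ⟨G₁, hG₁⟩ := hu₁C1.exists_norm_gradient_le hΩopen hΩbdd
  obtain ⟨G₂, hG₂⟩ := hu₂C1.exists_norm_gradient_le hΩopen hΩbdd
  obtain ⟨Gφ, hGφ⟩ := hφC1.exists_norm_gradient_le hΩopen hΩbdd
  obtain ⟨S₁, hS₁⟩ := hK.exists_bound_of_continuousOn hσ₁cont
  obtain ⟨S₂, hS₂⟩ := hK.exists_bound_of_continuousOn hσ₂cont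
  obtain ⟨L, hL⟩ := hK.exists_bound_of_continuousOn hM
  have hbound : ∀ {x v w : EuclideanSpace ℝ (Fin n)} {a b : ℝ}, x ∈ Ω → ‖v‖ ≤ a → ‖w‖ ≤ b →
      |⟪matCLM (A x) v, w⟫| ≤ L * a * b := by
    intro x v w a b hx hv hw
    have hLx := hL x (hsub hx)
    have hL0 : 0 ≤ L := (norm_nonneg _).trans hLx
    have ha0 : 0 ≤ a := (norm_nonneg _).trans hv
    exact (abs_real_inner_le_norm _ _).trans (by
      gcongr
      exact ((matCLM (A x)).le_opNorm v).trans (by gcongr))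
  have hApos : ∀ x ∈ Ω, ∀ ξ, 0 ≤ ⟪matCLM (A x) ξ, ξ⟫ := fun x hx ξ =>
    le_trans (by positivity) (hAell x hx ξ)
  have hlow : ∀ x ∈ Ω, c₀ / 4 ≤ ⟪matCLM (A x) (gradient u₂ x), gradient u₂ x⟫ := by
    intro x hx
    refine le_trans ?_ (hAell x hx _)
    have h := hu₂grad x hx
    have : (1 : ℝ) / 4 ≤ ‖gradient u₂ x‖ ^ 2 := by nlinarith
    nlinarith
  have hM' := hM.mono hsub
  have hp2 : 0 ≤ p / 2 := by linarith
  have henergy_int : ∀ {σ u : EuclideanSpace ℝ (Fin n) → ℝ} {S G : ℝ},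
      ContinuousOn σ (closure Ω) → ContinuousOn (gradient u) Ω →
      (∀ x ∈ closure Ω, ‖σ x‖ ≤ S) → (∀ x ∈ Ω, ‖gradient u x‖ ≤ G) →
      ContinuousOn (fun x => σ x *
        |⟪matCLM (A x) (gradient u x), gradient u x⟫| ^ (p / 2)) Ω ∧
      IntegrableOn (fun x => σ x *
        |⟪matCLM (A x) (gradient u x), gradient u x⟫| ^ (p / 2)) Ω := by
    intro σ u S G hσ hg hS hG
    have hcont : ContinuousOn (fun x => σ x *
        |⟪matCLM (A x) (gradient u x), gradient u x⟫| ^ (p / 2)) Ω :=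
      (hσ.mono hsub).mul
        ((((hM'.clm_apply hg).inner hg).abs).rpow_const fun _ _ => Or.inr hp2)
    refine ⟨hcont, hcont.integrableOn_of_forall_abs_le hΩopen hΩbdd
      (C := S * (L * G * G) ^ (p / 2)) fun x hx => ?_⟩
    have hSx := hS x (hsub hx)
    have hS0 : 0 ≤ S := (norm_nonneg _).trans hSx
    rw [abs_mul, abs_of_nonneg (Real.rpow_nonneg (abs_nonneg _) _)]
    gcongr
    · exact hSx
    · exact hbound hx (hG x hx) (hG x hx)
  obtain ⟨hc₁, hi₁⟩ := henergy_int hσ₁cont hg₁ hS₁ hG₁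
  obtain ⟨hc₂, hi₂⟩ := henergy_int hσ₂cont hg₂ hS₂ hG₂
  obtain ⟨R, hR⟩ := (isCompact_Icc (a := c₀ / 4) (b := L * G₂ * G₂)).exists_bound_of_continuousOn
    (f := fun t : ℝ => t ^ ((p - 2) / 2))
    (continuousOn_id.rpow_const fun t ht => Or.inl (by
      have : c₀ / 4 ≤ t := ht.1
      exact ne_of_gt (by simp only [id]; linarith)))
  have hcφ : ContinuousOn (fun x => σ₂ x *
      |⟪matCLM (A x) (gradient u₂ x), gradient u₂ x⟫| ^ ((p - 2) / 2) *
      ⟪matCLM (A x) (gradient u₂ x), gradient (u₁ - u₂) x⟫) Ω :=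
    ((hσ₂cont.mono hsub).mul
      ((((hM'.clm_apply hg₂).inner hg₂).abs).rpow_const fun x hx => Or.inl (by
        have := hlow x hx
        exact abs_ne_zero.2 (by linarith)))).mul ((hM'.clm_apply hg₂).inner hgφ)
  have hiφ := hcφ.integrableOn_of_forall_abs_le hΩopen hΩbdd
    (C := S₂ * R * (L * G₂ * Gφ)) fun x hx => by
      have hSx := hS₂ x (hsub hx)
      have hS0 : 0 ≤ S₂ := (norm_nonneg _).trans hSx
      have hRx := hR |⟪matCLM (A x) (gradient u₂ x), gradient u₂ x⟫|
        ⟨(hlow x hx).trans (le_abs_self _), hbound hx (hG₂ x hx) (hG₂ x hx)⟩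
      have hR0 : 0 ≤ R := (norm_nonneg _).trans hRx
      rw [abs_mul, abs_mul]
      gcongr
      · exact hSx
      · exact hRx
      · exact hbound hx (hG₂ x hx) (hGφ x hx)
  have hgrad : ∀ x ∈ Ω, gradient (u₁ - u₂) x = gradient u₁ x - gradient u₂ x := by
    intro x hx
    have hd₁ := (hu₁.differentiableOn one_ne_zero).differentiableAt (hΩopen.mem_nhds hx)
    have hd₂ := (hu₂.differentiableOn one_ne_zero).differentiableAt (hΩopen.mem_nhds hx)
    rw [gradient, fderiv_sub hd₁ hd₂, map_sub]
    rfl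
  have hconv : ∀ x ∈ Ω, |⟪matCLM (A x) (gradient u₂ x), gradient u₂ x⟫| ^ (p / 2) +
      p * (|⟪matCLM (A x) (gradient u₂ x), gradient u₂ x⟫| ^ ((p - 2) / 2) *
        ⟪matCLM (A x) (gradient u₂ x), gradient (u₁ - u₂) x⟫) ≤
      |⟪matCLM (A x) (gradient u₁ x), gradient u₁ x⟫| ^ (p / 2) := by
    intro x hx
    have hpos : 0 < ⟪matCLM (A x) (gradient u₂ x), gradient u₂ x⟫ := by
      linarith [hlow x hx]
    rw [hgrad x hx, inner_sub_right, abs_of_pos hpos, abs_of_nonneg (hApos x hx _)]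
    exact rpow_half_add_le hp1.le hpos (hApos x hx _)
      (inner_matCLM_sq_le (hAsymm x hx) (hApos x hx) hpos _)
  set F : EuclideanSpace ℝ (Fin n) → ℝ := fun x =>
    σ₁ x * |⟪matCLM (A x) (gradient u₁ x), gradient u₁ x⟫| ^ (p / 2) -
    σ₂ x * |⟪matCLM (A x) (gradient u₂ x), gradient u₂ x⟫| ^ (p / 2) -
    p * (σ₂ x * |⟪matCLM (A x) (gradient u₂ x), gradient u₂ x⟫| ^ ((p - 2) / 2) *
      ⟪matCLM (A x) (gradient u₂ x), gradient (u₁ - u₂) x⟫) with hF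
  have hFint : ∫ x in Ω, F x = 0 := by
    refine (integral_sub (hi₁.sub hi₂) (hiφ.const_mul p)).trans ?_
    rw [integral_const_mul,
      hu₂sol (u₁ - u₂) hφC1 fun x hx => sub_eq_zero.2 (hbdry x hx), mul_zero, sub_zero]
    exact (integral_sub hi₁ hi₂).trans (sub_eq_zero.2 henergy)
  have hFnonneg : ∀ x ∈ Ω, 0 ≤ F x := by
    intro x hx
    have hσ : 0 ≤ σ₂ x := hc₀.le.trans (hσ₂pos x hx)
    have h1 := mul_le_mul_of_nonneg_left (hconv x hx) hσ
    have h2 := mul_le_mul_of_nonneg_right (hmono x hx)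
      (Real.rpow_nonneg (abs_nonneg ⟪matCLM (A x) (gradient u₁ x), gradient u₁ x⟫) (p / 2))
    simp only [hF]
    linarith
  have hFzero : Set.EqOn F 0 Ω := by
    refine Measure.eqOn_open_of_ae_eq (μ := volume) ?_ hΩopen
      ((hc₁.sub hc₂).sub (hcφ.const_mul p)) continuousOn_const
    exact (setIntegral_eq_zero_iff_of_nonneg_ae
      ((ae_restrict_iff' hΩopen.measurableSet).2 (Filter.Eventually.of_forall hFnonneg))
      ((hi₁.sub hi₂).sub (hiφ.const_mul p))).1 hFint
  intro x hx
  by_contra hne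
  have hlt : 0 < σ₁ x - σ₂ x := sub_pos.2 (lt_of_le_of_ne (hmono x hx) (Ne.symm hne))
  have hσ : 0 < σ₂ x := hc₀.trans_le (hσ₂pos x hx)
  have hzero : F x = 0 := hFzero hx
  simp only [hF] at hzero
  have hσconv := mul_le_mul_of_nonneg_left (hconv x hx) hσ.le
  have hgrad₁ : gradient u₁ x = 0 := by
    by_contra hg
    have hpos : 0 < ⟪matCLM (A x) (gradient u₁ x), gradient u₁ x⟫ :=
      lt_of_lt_of_le (by positivity) (hAell x hx _)
    have := mul_pos hlt (Real.rpow_pos_of_pos (abs_pos.2 hpos.ne') (p / 2))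
    linarith
  have hpos : 0 < ⟪matCLM (A x) (gradient u₂ x), gradient u₂ x⟫ := by
    linarith [hlow x hx]
  have hsplit : ⟪matCLM (A x) (gradient u₂ x), gradient u₂ x⟫ ^ (p / 2) =
      ⟪matCLM (A x) (gradient u₂ x), gradient u₂ x⟫ ^ ((p - 2) / 2) *
        ⟪matCLM (A x) (gradient u₂ x), gradient u₂ x⟫ := by
    rw [← Real.rpow_add_one hpos.ne']
    congr 1
    ring
  have hp0 : p / 2 ≠ 0 := by linarith
  rw [hgrad x hx, hgrad₁, abs_of_pos hpos, hsplit] at hzero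
  simp only [map_zero, inner_zero_right, abs_zero, Real.zero_rpow hp0, zero_sub,
    inner_neg_right, mul_zero] at hzero
  have := mul_pos (sub_pos.2 hp1) (mul_pos hσ (mul_pos
    (Real.rpow_pos_of_pos hpos ((p - 2) / 2)) hpos))
  linarith
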